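/- Let d ≥ 2 and α = d. For every δ > 0 there exists ρ₀ > 0 such that for every intensity 0 < ρ ≤ ρ₀ and every i ∈ {1,2,3}, the Poincaré constant satisfies γ^i(L) ≥ L^{1/δ}, P_{*,ρ}-a.s. for all sufficiently large L. -/

import Mathlib

open MeasureTheory Filter
open scoped ENNReal

noncomputable section

abbrev Pt (d : ℕ) := EuclideanSpace ℝ (Fin d)
abbrev Config (d : ℕ) := Set (Pt d)

def IsLocallyFinite {d : ℕ} (ξ : Config d) : Prop :=
  ∀ A : Set (Pt d), Bornology.IsBounded A → (ξ ∩ A).Finite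

instance configMS (d : ℕ) : MeasurableSpace (Config d) :=
  MeasurableSpace.generateFrom
    { E | ∃ (A : Set (Pt d)) (n : ℕ), Bornology.IsBounded A ∧ MeasurableSet A ∧
        E = {ξ : Config d | (ξ ∩ A).ncard = n} }

def IsPointProcess {d : ℕ} (P : Measure (Config d)) : Prop :=
  IsProbabilityMeasure P ∧ ∀ᵐ ξ ∂P, IsLocallyFinite ξ

def cube (d : ℕ) (L : ℝ) : Set (Pt d) := {p | ∀ i, |p i| ≤ L / 2}

/-- The cube `B_x = Kx + [0,K)^d`. -/
def Kcube (d : ℕ) (K : ℝ) (x : Fin d → ℤ) : Set (Pt d) :=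
  {p | ∀ i, K * x i ≤ p i ∧ p i < K * x i + K}

/-- Bernoulli(p) i.i.d. field on `ℤ^d`, characterized by its cylinder probabilities. -/
def IsBernoulliField (d : ℕ) (p : ℝ) (ν : Measure ((Fin d → ℤ) → Bool)) : Prop :=
  IsProbabilityMeasure ν ∧
  ∀ (S : Finset (Fin d → ℤ)) (b : (Fin d → ℤ) → Bool),
    ν {ω | ∀ x ∈ S, ω x = b x} = ∏ x ∈ S, ENNReal.ofReal (if b x then p else 1 - p)

/-- Assumption (A1): for every p < 1 there is K such that the good-box field
dominates an i.i.d. Bernoulli(p) field, in the sense of a monotone coupling. -/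
def AssumptionA1 {d : ℕ} (P : Measure (Config d)) : Prop :=
  ∀ p : ℝ, 0 < p → p < 1 → ∃ K : ℝ, 0 < K ∧
    ∃ (μ : Measure (Config d × ((Fin d → ℤ) → Bool))) (ν : Measure ((Fin d → ℤ) → Bool)),
      IsProbabilityMeasure μ ∧ IsBernoulliField d p ν ∧
      μ.map Prod.fst = P ∧ μ.map Prod.snd = ν ∧
      ∀ᵐ ω ∂μ, ∀ x : Fin d → ℤ, ω.2 x = true → (ω.1 ∩ Kcube d K x).Nonempty

/-- `R_A(ξ) = Σ_{x ∈ ξ∩A} Σ_{y ∈ ξ} exp(-|x-y|^α)` (valued in `ℝ≥0∞`). -/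
def Rfun {d : ℕ} (α : ℝ) (A : Set (Pt d)) (ξ : Config d) : ℝ≥0∞ :=
  ∑' (x : ↥(ξ ∩ A)) (y : ↥ξ), ENNReal.ofReal (Real.exp (-(dist (x : Pt d) (y : Pt d)) ^ α))

/-- The cube `V_x = L^ε x + [0, L^ε)^d`. -/
def Vcube (d : ℕ) (L : ℕ) (ε : ℝ) (x : Fin d → ℤ) : Set (Pt d) :=
  {p | ∀ i, (L : ℝ) ^ ε * x i ≤ p i ∧ p i < (L : ℝ) ^ ε * x i + (L : ℝ) ^ ε}

/-- Assumption (A2). -/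
def AssumptionA2 {d : ℕ} (α : ℝ) (P : Measure (Config d)) : Prop :=
  ∀ ε : ℝ, 0 < ε → ε < 1 → ∃ C : ℝ, 0 < C ∧
    ∀ᵐ ξ ∂P, ∀ᶠ L : ℕ in atTop,
      ∀ x : Fin d → ℤ, (Vcube d L ε x ∩ cube d L).Nonempty →
        Rfun α (Vcube d L ε x) ξ ≤ ENNReal.ofReal (C * (L : ℝ) ^ (ε * d))

noncomputable instance {d : ℕ} : DecidableEq (Pt d) := Classical.decEq _

variable {d : ℕ}

/-- jump rate `e^{-|x-y|^α}`. -/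
def rate (α : ℝ) (x y : Pt d) : ℝ := Real.exp (-(dist x y) ^ α)

/-- weights `w^i_x` for the three models `i = 1,2,3`. -/
def wgt (α : ℝ) (E : Finset (Pt d)) (i : ℕ) (x : Pt d) : ℝ :=
  if i = 1 then 1
  else if i = 2 then ∑ z ∈ E.erase x, rate α x z
  else max 1 (∑ z ∈ E.erase x, rate α x z)

/-- `W^i(U) = Σ_{x∈U} w^i_x`. -/
def Wsum (α : ℝ) (E : Finset (Pt d)) (i : ℕ) (U : Finset (Pt d)) : ℝ :=
  ∑ x ∈ U, wgt α E i x

/-- the reversible probability measure `ν^i(x) = w^i_x / W^i(ξ_L)`. -/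
def nu (α : ℝ) (E : Finset (Pt d)) (i : ℕ) (x : Pt d) : ℝ :=
  wgt α E i x / Wsum α E i E

/-- conductance `I^i_U`. -/
def conduct (α : ℝ) (E : Finset (Pt d)) (i : ℕ) (U : Finset (Pt d)) : ℝ :=
  (∑ x ∈ U, ∑ y ∈ E \ U, rate α x y) / Wsum α E i U

/-- isoperimetric profile `φ^i_L(t)` (valued in `ℝ≥0∞`; `∞` if no admissible `U`). -/
def isoProfile (α : ℝ) (E : Finset (Pt d)) (i : ℕ) (t : ℝ) : ℝ≥0∞ :=
  ⨅ (U : Finset (Pt d)) (_ : U ⊆ E) (_ : U.Nonempty)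
    (_ : Wsum α E i U ≤ t * Wsum α E i E), ENNReal.ofReal (conduct α E i U)

/-- Cheeger's constant `Φ^i_L = φ^i_L(1/2)`. -/
def cheeger (α : ℝ) (E : Finset (Pt d)) (i : ℕ) : ℝ≥0∞ := isoProfile α E i (1 / 2)

/-- Dirichlet form `E_i(f)`. -/
def dirichlet (α : ℝ) (E : Finset (Pt d)) (i : ℕ) (f : Pt d → ℝ) : ℝ :=
  (1 / 2) * ∑ x ∈ E, ∑ y ∈ E.erase x,
    nu α E i x * (rate α x y / wgt α E i x) * (f x - f y) ^ 2

/-- variance `Var_i(f) = ν^i(f²) - ν^i(f)²`. -/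
def varNu (α : ℝ) (E : Finset (Pt d)) (i : ℕ) (f : Pt d → ℝ) : ℝ :=
  (∑ x ∈ E, nu α E i x * f x ^ 2) - (∑ x ∈ E, nu α E i x * f x) ^ 2

/-- nonconstant on `E`. -/
def Nonconst (E : Finset (Pt d)) (f : Pt d → ℝ) : Prop := ∃ x ∈ E, ∃ y ∈ E, f x ≠ f y

/-- Poincaré constant `γ^i(L) = sup { Var_i f / E_i f : f nonconstant }`. -/
def gammaP (α : ℝ) (E : Finset (Pt d)) (i : ℕ) : ℝ≥0∞ :=
  ⨆ (f : Pt d → ℝ) (_ : Nonconst E f),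
    ENNReal.ofReal (varNu α E i f / dirichlet α E i f)

/-- the generator `L^i` as a matrix on `E`. -/
def gen (α : ℝ) (E : Finset (Pt d)) (i : ℕ) : Matrix ↥E ↥E ℝ :=
  Matrix.of fun x y =>
    if x = y then -(∑ z ∈ E.erase (x : Pt d), rate α (x : Pt d) z / wgt α E i (x : Pt d))
    else rate α (x : Pt d) (y : Pt d) / wgt α E i (x : Pt d)

/-- heat kernel `H^i_t = exp(t L^i)`, via the exponential series. -/
def heatKernel (α : ℝ) (E : Finset (Pt d)) (i : ℕ) (t : ℝ) (x y : ↥E) : ℝ :=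
  ∑' n : ℕ, t ^ n / (n.factorial : ℝ) * (gen α E i ^ n) x y

/-- uniform mixing time `τ^i(L)` (valued in `ℝ≥0∞`). -/
def mixTime (α : ℝ) (E : Finset (Pt d)) (i : ℕ) : ℝ≥0∞ :=
  ⨅ (t : ℝ) (_ : 0 < t)
    (_ : ∀ x y : ↥E,
      |heatKernel α E i t x y - nu α E i (y : Pt d)| / nu α E i (y : Pt d) ≤ Real.exp (-1)),
    ENNReal.ofReal t

/-- `c₀⁺(U)`: nonnegative, nonconstant, vanishing outside `U`. -/
def c0plus (E U : Finset (Pt d)) (f : Pt d → ℝ) : Prop :=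
  (∀ x ∈ E, 0 ≤ f x) ∧ Nonconst E f ∧ ∀ x ∈ E, x ∉ U → f x = 0

/-- `λ^i(U) = inf { E_i f / Var_i f : f ∈ c₀⁺(U) }`. -/
def lambdaU (α : ℝ) (E : Finset (Pt d)) (i : ℕ) (U : Finset (Pt d)) : ℝ :=
  sInf {r : ℝ | ∃ f : Pt d → ℝ, c0plus E U f ∧ r = dirichlet α E i f / varNu α E i f}

/-- `ν^i_* = min_{x∈E} ν^i(x)`. -/
def nuStar (α : ℝ) (E : Finset (Pt d)) (i : ℕ) : ℝ :=
  sInf (nu α E i '' ↑E)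

/-- `ν^i(U)` for a subset `U`. -/
def nuSet (α : ℝ) (E : Finset (Pt d)) (i : ℕ) (U : Finset (Pt d)) : ℝ :=
  ∑ x ∈ U, nu α E i x

/-- spectral profile `Λ^i(r)`. -/
def specProfile (α : ℝ) (E : Finset (Pt d)) (i : ℕ) (r : ℝ) : ℝ :=
  sInf {l : ℝ | ∃ U : Finset (Pt d), U ⊆ E ∧
    nuStar α E i ≤ nuSet α E i U ∧ nuSet α E i U ≤ r ∧ l = lambdaU α E i U}

/-- hybrid conductance profile `ψ_L(t)`: model-3 conductance, counting constraint. -/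
def hybridProfile (α : ℝ) (E : Finset (Pt d)) (t : ℝ) : ℝ≥0∞ :=
  ⨅ (U : Finset (Pt d)) (_ : U ⊆ E) (_ : U.Nonempty)
    (_ : (U.card : ℝ) ≤ t * (E.card : ℝ)), ENNReal.ofReal (conduct α E 3 U)

/-- homogeneous Poisson point process of intensity `ρ`, characterized by
independence and Poisson distribution of the counting variables. -/
def IsPoissonPP (d : ℕ) (ρ : ℝ) (P : Measure (Config d)) : Prop :=
  IsProbabilityMeasure P ∧ (∀ᵐ ξ ∂P, IsLocallyFinite ξ) ∧
  ∀ (k : ℕ) (A : Fin k → Set (Pt d)),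
    (∀ j, Bornology.IsBounded (A j)) → (∀ j, MeasurableSet (A j)) →
    (Pairwise fun j j' => Disjoint (A j) (A j')) →
    ∀ m : Fin k → ℕ,
      P {ξ | ∀ j, (ξ ∩ A j).ncard = m j} =
        ∏ j, ENNReal.ofReal (Real.exp (-ρ * (volume (A j)).toReal) *
          (ρ * (volume (A j)).toReal) ^ (m j) / ((m j).factorial : ℝ))

lemma rate_pos (α : ℝ) (x y : Pt d) : 0 < rate α x y := Real.exp_pos _

lemma rate_comm (α : ℝ) (x y : Pt d) : rate α x y = rate α y x := by
  simp only [rate, dist_comm]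

lemma le_wgt {α κ : ℝ} {E : Finset (Pt d)} (i : ℕ) {x y : Pt d} (hκ : κ ≤ 1)
    (hy : y ∈ E) (hxy : y ≠ x) (h : κ ≤ rate α x y) : κ ≤ wgt α E i x := by
  have hsum : κ ≤ ∑ z ∈ E.erase x, rate α x z :=
    h.trans (Finset.single_le_sum (f := fun z => rate α x z) (fun z _ => (rate_pos α x z).le)
      (Finset.mem_erase.2 ⟨hxy, hy⟩))
  unfold wgt
  split_ifs
  · exact hκ
  · exact hsum
  · exact hκ.trans (le_max_left _ _)

lemma wgt_pos {α : ℝ} {E : Finset (Pt d)} (i : ℕ) {x y : Pt d}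
    (hy : y ∈ E) (hxy : y ≠ x) : 0 < wgt α E i x :=
  (lt_min one_pos (rate_pos α x y)).trans_le
    (le_wgt i (min_le_left _ _) hy hxy (min_le_right _ _))

/-- Testing the Poincaré inequality on the indicator of a weakly connected set `U` that carries at
most half of the reversible measure. -/
lemma le_gammaP_of_weakly_connected {α κ η : ℝ} {E U V : Finset (Pt d)} {i : ℕ} (hκ : 0 < κ)
    (hη : 0 < η) (hU : U ⊆ E) (hV : V ⊆ E) (hUne : U.Nonempty) (hVne : V.Nonempty)
    (hUV : Disjoint U V) (hw : ∀ x ∈ U, κ ≤ wgt α E i x)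
    (hle : Wsum α E i U ≤ Wsum α E i V)
    (hcut : ∀ x ∈ U, ∀ y ∈ E, y ∉ U → rate α x y ≤ η) :
    ENNReal.ofReal (κ / (2 * η * E.card)) ≤ gammaP α E i := by
  classical
  obtain ⟨u, hu⟩ := hUne
  obtain ⟨v, hv⟩ := hVne
  have hvU : v ∉ U := fun h => Finset.disjoint_left.1 hUV h hv
  have hne : u ≠ v := fun h => hvU (h ▸ hu)
  have hpos : ∀ x ∈ E, 0 < wgt α E i x := by
    intro x _
    by_cases hx : x = u
    · exact wgt_pos i (hV hv) (by rw [hx]; exact hne.symm)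
    · exact wgt_pos i (hU hu) (Ne.symm hx)
  set W := Wsum α E i E with hW
  have hWpos : 0 < W := Finset.sum_pos hpos ⟨u, hU hu⟩
  set f : Pt d → ℝ := fun x => if x ∈ U then 1 else 0 with hf
  have hWU : κ * U.card ≤ Wsum α E i U := by
    unfold Wsum
    calc κ * U.card = ∑ x ∈ U, κ := by rw [Finset.sum_const, nsmul_eq_mul, mul_comm]
      _ ≤ _ := Finset.sum_le_sum hw
  have hUcard : (0 : ℝ) < U.card := by exact_mod_cast Finset.card_pos.2 ⟨u, hu⟩
  have hEcard : (0 : ℝ) < E.card := by exact_mod_cast Finset.card_pos.2 ⟨u, hU hu⟩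
  have h2 : 2 * Wsum α E i U ≤ W := by
    have : Wsum α E i U + Wsum α E i V ≤ W := by
      rw [hW]; unfold Wsum
      rw [← Finset.sum_union hUV]
      exact Finset.sum_le_sum_of_subset_of_nonneg (Finset.union_subset hU hV)
        fun x hx _ => (hpos x hx).le
    linarith
  have hterm : ∀ x ∈ E, ∀ y : Pt d,
      nu α E i x * (rate α x y / wgt α E i x) * (f x - f y) ^ 2
        = rate α x y / W * (f x - f y) ^ 2 := by
    intro x hx y
    have := (hpos x hx).ne'
    unfold nu
    rw [← hW]
    field_simp
  have hfsum : ∑ x ∈ E, f x = U.card := by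
    simp only [hf, Finset.sum_ite_mem, Finset.inter_eq_right.2 hU]
    simp
  have hnu : ∑ x ∈ E, nu α E i x * f x = Wsum α E i U / W := by
    simp only [hf, mul_ite, mul_one, mul_zero, Finset.sum_ite_mem, Finset.inter_eq_right.2 hU]
    unfold nu Wsum
    rw [Finset.sum_div, hW]
    rfl
  have hvar : varNu α E i f = Wsum α E i U / W * (1 - Wsum α E i U / W) := by
    unfold varNu
    have : ∀ x, f x ^ 2 = f x := fun x => by simp only [hf]; split_ifs <;> simp
    simp only [this, hnu]
    ring
  have hdir : dirichlet α E i f ≤ U.card * E.card * η / W := by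
    have hb : ∀ x ∈ E, ∀ y ∈ E,
        rate α x y / W * (f x - f y) ^ 2 ≤ (f x + f y) * (η / W) := by
      intro x hx y hy
      simp only [hf]
      by_cases hxU : x ∈ U <;> by_cases hyU : y ∈ U <;> simp only [hxU, hyU, if_true, if_false]
      · norm_num; positivity
      · have := hcut x hxU y hy hyU
        norm_num
        gcongr
      · have := hcut y hyU x hx hxU
        rw [rate_comm] at this
        norm_num
        gcongr
      · norm_num
    have hfn : ∀ x, 0 ≤ f x := fun x => by simp only [hf]; split_ifs <;> simp
    calc dirichlet α E i f
        = 1 / 2 * ∑ x ∈ E, ∑ y ∈ E.erase x, rate α x y / W * (f x - f y) ^ 2 := by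
          unfold dirichlet
          congr 1
          exact Finset.sum_congr rfl fun x hx => Finset.sum_congr rfl fun y _ => hterm x hx y
      _ ≤ 1 / 2 * ∑ x ∈ E, ∑ y ∈ E, (f x + f y) * (η / W) := by
          gcongr with x hx
          refine (Finset.sum_le_sum fun y hy => hb x hx y (Finset.mem_of_mem_erase hy)).trans ?_
          refine Finset.sum_le_sum_of_subset_of_nonneg (Finset.erase_subset _ _) fun y _ _ => ?_
          have := hfn x
          have := hfn y
          positivity
      _ = U.card * E.card * η / W := by
          simp only [← Finset.sum_mul, Finset.sum_add_distrib, hfsum, Finset.sum_const,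
            nsmul_eq_mul, ← Finset.mul_sum]
          ring
  have hdirpos : 0 < dirichlet α E i f := by
    have hnn : ∀ x ∈ E, ∀ y ∈ E.erase x,
        0 ≤ nu α E i x * (rate α x y / wgt α E i x) * (f x - f y) ^ 2 := by
      intro x hx y _
      rw [hterm x hx y]
      have := rate_pos α x y
      positivity
    unfold dirichlet
    refine mul_pos (by norm_num) ?_
    refine Finset.sum_pos' (fun x hx => Finset.sum_nonneg (hnn x hx)) ⟨u, hU hu, ?_⟩
    refine Finset.sum_pos' (hnn u (hU hu)) ⟨v, Finset.mem_erase.2 ⟨hne.symm, hV hv⟩, ?_⟩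
    rw [hterm u (hU hu) v]
    have := rate_pos α u v
    simp only [hf, hu, hvU, if_true, if_false]
    norm_num
    positivity
  have hratio : κ / (2 * η * E.card) ≤ varNu α E i f / dirichlet α E i f := by
    rw [le_div_iff₀ hdirpos]
    calc κ / (2 * η * E.card) * dirichlet α E i f
        ≤ κ / (2 * η * E.card) * (U.card * E.card * η / W) := by gcongr
      _ = κ * U.card / W * (1 / 2) := by field_simp
      _ ≤ Wsum α E i U / W * (1 - Wsum α E i U / W) := by
          have h3 : Wsum α E i U / W ≤ 1 / 2 := by
            rw [div_le_iff₀ hWpos]; linarith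
          have h4 : (0 : ℝ) ≤ Wsum α E i U := le_trans (by positivity) hWU
          have h5 : κ * U.card / W ≤ Wsum α E i U / W := by gcongr
          have h6 : 0 ≤ Wsum α E i U / W := by positivity
          nlinarith
      _ = varNu α E i f := hvar.symm
  refine (ENNReal.ofReal_le_ofReal hratio).trans ?_
  unfold gammaP
  refine le_iSup₂ (f := fun (f : Pt d → ℝ) (_ : Nonconst E f) =>
    ENNReal.ofReal (varNu α E i f / dirichlet α E i f)) f ⟨u, hU hu, v, hV hv, ?_⟩
  simp [hf, hu, hvU]

/-- The closed cube of half-side `r` centred at the point whose coordinates all equal `a`. -/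
def diagBox (d : ℕ) (a r : ℝ) : Set (Pt d) := {p | ∀ i, |p i - a| ≤ r}

lemma cube_eq_diagBox (L : ℝ) : cube d L = diagBox d 0 (L / 2) := by
  simp [cube, diagBox]

lemma diagBox_subset {a b r s : ℝ} (h : |a - b| + r ≤ s) : diagBox d a r ⊆ diagBox d b s := by
  intro p hp i
  have h1 := hp i
  have h2 := abs_sub_le (p i) a b
  linarith

lemma disjoint_diagBox [NeZero d] {a b r : ℝ} (h : 2 * r < |a - b|) :
    Disjoint (diagBox d a r) (diagBox d b r) := by
  rw [Set.disjoint_left]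
  intro p hp hq
  have h1 := hp 0
  have h2 := hq 0
  have h3 := abs_sub_le a (p 0) b
  rw [abs_sub_comm a (p 0)] at h3
  linarith

lemma diagBox_eq_preimage (a r : ℝ) : diagBox d a r =
    WithLp.ofLp ⁻¹' Set.Icc (fun _ : Fin d => a - r) (fun _ => a + r) := by
  ext p
  simp only [diagBox, Set.mem_ofPred_eq, Set.mem_preimage, Set.mem_Icc, Pi.le_def, abs_le,
    ← forall_and]
  refine forall_congr' fun i => and_congr ?_ ?_ <;> constructor <;> intro h <;> linarith

lemma measurableSet_diagBox (a r : ℝ) : MeasurableSet (diagBox d a r) := by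
  rw [diagBox_eq_preimage]
  exact (PiLp.volume_preserving_ofLp (Fin d)).measurable measurableSet_Icc

lemma volume_diagBox (a : ℝ) {r : ℝ} (hr : 0 ≤ r) :
    volume (diagBox d a r) = ENNReal.ofReal ((2 * r) ^ d) := by
  rw [diagBox_eq_preimage, (PiLp.volume_preserving_ofLp (Fin d)).measure_preimage
    measurableSet_Icc.nullMeasurableSet, Real.volume_Icc_pi]
  simp only [Finset.prod_const, Finset.card_univ, Fintype.card_fin]
  rw [ENNReal.ofReal_pow (by positivity)]
  congr 2
  ring

lemma dist_le_of_mem_diagBox {a r : ℝ} {x y : Pt d} (hx : x ∈ diagBox d a r)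
    (hy : y ∈ diagBox d a r) : dist x y ≤ d * (2 * r) := by
  rw [EuclideanSpace.dist_eq]
  by_cases hd : d = 0
  · subst hd; simp
  have hr : 0 ≤ r := (abs_nonneg _).trans (hx ⟨0, Nat.pos_of_ne_zero hd⟩)
  refine Real.sqrt_le_iff.2 ⟨by positivity, ?_⟩
  calc ∑ i, dist (x i) (y i) ^ 2 ≤ ∑ _i : Fin d, (2 * r) ^ 2 := by
        gcongr with i
        have h1 := hx i
        have h2 := hy i
        have h3 := abs_sub_le (x i) a (y i)
        rw [abs_sub_comm a] at h3
        rw [Real.dist_eq]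
        linarith
    _ = d * (2 * r) ^ 2 := by simp
    _ ≤ (d * (2 * r)) ^ 2 := by
        rw [mul_pow (d : ℝ)]
        have : (1 : ℝ) ≤ d := by exact_mod_cast Nat.pos_of_ne_zero hd
        exact mul_le_mul_of_nonneg_right (by nlinarith) (sq_nonneg _)

lemma isBounded_diagBox (a r : ℝ) : Bornology.IsBounded (diagBox d a r) :=
  Metric.isBounded_iff.2 ⟨_, fun _ hx _ hy => dist_le_of_mem_diagBox hx hy⟩

lemma le_dist_of_mem_diagBox {a r s : ℝ} {x y : Pt d} (hx : x ∈ diagBox d a s)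
    (hy : y ∉ diagBox d a r) : r - s ≤ dist x y := by
  simp only [diagBox, Set.mem_ofPred_eq, not_forall, not_le] at hy
  obtain ⟨i, hi⟩ := hy
  have h1 := hx i
  have h2 := abs_sub_le (y i) (x i) a
  have h3 : |x i - y i| ≤ dist x y := by
    rw [dist_eq_norm]
    exact PiLp.norm_apply_le (x - y) i
  rw [abs_sub_comm (y i) (x i)] at h2
  linarith

lemma measurableSet_ncard_inter_eq {A : Set (Pt d)} (hb : Bornology.IsBounded A)
    (hm : MeasurableSet A) (n : ℕ) : MeasurableSet {ξ : Config d | (ξ ∩ A).ncard = n} :=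
  MeasurableSpace.measurableSet_generateFrom ⟨A, n, hb, hm, rfl⟩

lemma IsPoissonPP.measure_forall_ncard {ρ : ℝ} {P : Measure (Config d)} (hP : IsPoissonPP d ρ P)
    {ι : Type*} [Fintype ι] (A : ι → Set (Pt d)) (hb : ∀ j, Bornology.IsBounded (A j))
    (hm : ∀ j, MeasurableSet (A j)) (hd : Pairwise fun j k => Disjoint (A j) (A k)) (m : ι → ℕ) :
    P {ξ | ∀ j, (ξ ∩ A j).ncard = m j} =
      ∏ j, ENNReal.ofReal (Real.exp (-ρ * (volume (A j)).toReal) *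
        (ρ * (volume (A j)).toReal) ^ (m j) / ((m j).factorial : ℝ)) := by
  set e := (Fintype.equivFin ι).symm
  have h := hP.2.2 (Fintype.card ι) (A ∘ e) (fun j => hb _) (fun j => hm _)
    (fun j k hjk => hd (e.injective.ne hjk)) (m ∘ e)
  rw [← e.prod_comp]
  refine Eq.trans ?_ h
  congr 1
  ext ξ
  simp only [Set.mem_ofPred_eq, Function.comp_apply]
  exact e.forall_congr_right.symm

lemma IsPoissonPP.measure_ncard {ρ : ℝ} {P : Measure (Config d)} (hP : IsPoissonPP d ρ P)
    {A : Set (Pt d)} (hb : Bornology.IsBounded A) (hm : MeasurableSet A) (n : ℕ) :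
    P {ξ | (ξ ∩ A).ncard = n} = ENNReal.ofReal (Real.exp (-ρ * (volume A).toReal) *
      (ρ * (volume A).toReal) ^ n / (n.factorial : ℝ)) := by
  simpa using hP.measure_forall_ncard (ι := Unit) (fun _ => A) (fun _ => hb) (fun _ => hm)
    (fun j k hjk => (hjk rfl).elim) (fun _ => n)

lemma hasSum_mul_poisson (l : ℝ) :
    HasSum (fun n : ℕ => (n : ℝ) * (Real.exp (-l) * l ^ n / (n.factorial : ℝ))) l := by
  rw [← hasSum_nat_add_iff' 1]
  have h := (NormedSpace.expSeries_div_hasSum_exp l).mul_left (l * Real.exp (-l))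
  rw [← congrFun Real.exp_eq_exp_ℝ l, mul_assoc, ← Real.exp_add] at h
  simp only [neg_add_cancel, Real.exp_zero, mul_one] at h
  simp only [Finset.range_one, Finset.sum_singleton, Nat.cast_zero, zero_mul, sub_zero]
  have heq : (fun n : ℕ => l * Real.exp (-l) * (l ^ n / (n.factorial : ℝ))) =
      fun n : ℕ => ((n + 1 : ℕ) : ℝ) * (Real.exp (-l) * l ^ (n + 1) / ((n + 1).factorial : ℝ)) := by
    funext n
    have : (n.factorial : ℝ) ≠ 0 := by positivity
    rw [Nat.factorial_succ]
    push_cast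
    field_simp
    ring
  rwa [heq] at h

/-- Markov's inequality for the counting variables of a Poisson process. -/
lemma IsPoissonPP.measure_le_ncard {ρ : ℝ} {P : Measure (Config d)} (hP : IsPoissonPP d ρ P)
    (hρ : 0 ≤ ρ) {A : Set (Pt d)} (hb : Bornology.IsBounded A) (hm : MeasurableSet A)
    {K : ℝ} (hK : 0 < K) :
    P {ξ | K ≤ (ξ ∩ A).ncard} ≤ ENNReal.ofReal (ρ * (volume A).toReal / K) := by
  set l := ρ * (volume A).toReal with hl
  have hl0 : 0 ≤ l := by positivity
  set N : Config d → ℕ := fun ξ => (ξ ∩ A).ncard with hN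
  have hNm : Measurable N :=
    measurable_to_countable' fun n => measurableSet_ncard_inter_eq hb hm n
  have hmean : ∫⁻ ξ, (N ξ : ℝ≥0∞) ∂P = ENNReal.ofReal l := by
    have h1 : ∫⁻ ξ, (N ξ : ℝ≥0∞) ∂P = ∫⁻ n, (n : ℝ≥0∞) ∂(P.map N) :=
      (lintegral_map (f := fun n : ℕ => (n : ℝ≥0∞)) (measurable_of_countable _) hNm).symm
    rw [h1, lintegral_countable']
    have h2 : ∀ n : ℕ, (n : ℝ≥0∞) * (P.map N) {n} =
        ENNReal.ofReal ((n : ℝ) * (Real.exp (-l) * l ^ n / (n.factorial : ℝ))) := by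
      intro n
      rw [Measure.map_apply hNm (measurableSet_singleton n),
        ENNReal.ofReal_mul (Nat.cast_nonneg n), ENNReal.ofReal_natCast]
      congr 1
      have := hP.measure_ncard hb hm n
      rw [← neg_mul_eq_neg_mul, ← hl] at this
      exact this
    simp_rw [h2]
    rw [← ENNReal.ofReal_tsum_of_nonneg (fun n => by positivity) (hasSum_mul_poisson l).summable,
      (hasSum_mul_poisson l).tsum_eq]
  have h3 := meas_ge_le_lintegral_div (μ := P) (f := fun ξ => (N ξ : ℝ≥0∞))
    (ε := ENNReal.ofReal K)
    ((measurable_of_countable (fun n : ℕ => (n : ℝ≥0∞))).comp hNm).aemeasurable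
    (by simpa using hK) ENNReal.ofReal_ne_top
  rw [hmean, ← ENNReal.ofReal_div_of_pos hK] at h3
  refine le_trans (measure_mono fun ξ hξ => ?_) h3
  simp only [Set.mem_ofPred_eq] at hξ ⊢
  rw [← ENNReal.ofReal_natCast]
  exact ENNReal.ofReal_le_ofReal hξ

/-- The configurations with exactly two points in the unit cube around the diagonal point `a` and
no point in the surrounding shell of half-side `r`. -/
def isolatedPair (d : ℕ) (a r : ℝ) : Set (Config d) :=
  {ξ | (ξ ∩ diagBox d a (1 / 2)).ncard = 2 ∧
    (ξ ∩ (diagBox d a r \ diagBox d a (1 / 2))).ncard = 0}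

lemma measurableSet_isolatedPair (a r : ℝ) : MeasurableSet (isolatedPair d a r) :=
  (measurableSet_ncard_inter_eq (isBounded_diagBox _ _) (measurableSet_diagBox _ _) 2).inter
    (measurableSet_ncard_inter_eq ((isBounded_diagBox _ _).subset Set.sdiff_subset)
      ((measurableSet_diagBox _ _).diff (measurableSet_diagBox _ _)) 0)

lemma toReal_volume_diagBox_diff (a : ℝ) {r : ℝ} (hr : 1 / 2 ≤ r) :
    (volume (diagBox d a r \ diagBox d a (1 / 2))).toReal = (2 * r) ^ d - 1 := by
  rw [measure_sdiff (diagBox_subset (by simpa using hr))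
    (measurableSet_diagBox _ _).nullMeasurableSet (isBounded_diagBox _ _).measure_lt_top.ne,
    volume_diagBox _ (by linarith), volume_diagBox _ (by norm_num)]
  norm_num
  rw [ENNReal.toReal_sub_of_le _ ENNReal.ofReal_ne_top, ENNReal.toReal_ofReal (by positivity)]
  · simp
  · rw [← ENNReal.ofReal_one]
    exact ENNReal.ofReal_le_ofReal (one_le_pow₀ (by linarith))

lemma IsPoissonPP.measure_biInter_isolatedPair [NeZero d] {ρ : ℝ} {P : Measure (Config d)}
    (hP : IsPoissonPP d ρ P) {r : ℝ} (hr : 1 / 2 ≤ r) {a : ℕ → ℝ}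
    (ha : Pairwise fun j k => 2 * r < |a j - a k|) (S : Finset ℕ) :
    P (⋂ j ∈ S, isolatedPair d (a j) r) =
      ∏ _j ∈ S, ENNReal.ofReal (ρ ^ 2 / 2 * Real.exp (-(ρ * (2 * r) ^ d))) := by
  have hsub : ∀ x, diagBox d x (1 / 2) ⊆ diagBox d x r := fun x =>
    diagBox_subset (by simpa using hr)
  set A : ↥S × Bool → Set (Pt d) := fun q =>
    if q.2 then diagBox d (a q.1) (1 / 2) else diagBox d (a q.1) r \ diagBox d (a q.1) (1 / 2)
    with hA
  have hAsub : ∀ q, A q ⊆ diagBox d (a q.1) r := by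
    rintro ⟨j, b⟩
    cases b
    · exact Set.sdiff_subset
    · exact hsub _
  have hAm : ∀ q, MeasurableSet (A q) := by
    rintro ⟨j, b⟩
    cases b
    · exact (measurableSet_diagBox _ _).diff (measurableSet_diagBox _ _)
    · exact measurableSet_diagBox _ _
  have hAd : Pairwise fun q q' => Disjoint (A q) (A q') := by
    rintro ⟨j, b⟩ ⟨k, c⟩ hne
    by_cases hjk : j = k
    · subst hjk
      cases b <;> cases c <;> simp only [ne_eq, not_true_eq_false] at hne
      · simpa [hA] using Set.disjoint_sdiff_left
      · simpa [hA] using Set.disjoint_sdiff_right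
    · exact (disjoint_diagBox (ha fun h => hjk (Subtype.ext h))).mono (hAsub (j, b)) (hAsub (k, c))
  have h := hP.measure_forall_ncard A (fun q => (isBounded_diagBox _ _).subset (hAsub q)) hAm hAd
    (fun q => if q.2 then 2 else 0)
  have hset : (⋂ j ∈ S, isolatedPair d (a j) r) =
      {ξ | ∀ q : ↥S × Bool, (ξ ∩ A q).ncard = if q.2 then 2 else 0} := by
    ext ξ
    simp [isolatedPair, hA, Prod.forall, and_comm]
  rw [hset, h, Fintype.prod_prod_type, ← Finset.prod_coe_sort S]
  refine Finset.prod_congr rfl fun j _ => ?_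
  rw [Fintype.prod_bool]
  simp only [hA, if_true, Bool.false_eq_true, if_false]
  rw [toReal_volume_diagBox_diff _ hr, volume_diagBox _ (by norm_num),
    ← ENNReal.ofReal_mul (by positivity)]
  congr 1
  norm_num
  rw [show -(ρ * (2 * r) ^ d) = -ρ + -(ρ * ((2 * r) ^ d - 1)) by ring, Real.exp_add]
  ring

lemma IsPoissonPP.measure_forall_notMem_isolatedPair [NeZero d] {ρ : ℝ} {P : Measure (Config d)}
    (hP : IsPoissonPP d ρ P) {r : ℝ} (hr : 1 / 2 ≤ r) {a : ℕ → ℝ}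
    (ha : Pairwise fun j k => 2 * r < |a j - a k|) (M : ℕ) :
    P {ξ | ∀ j < M, ξ ∉ isolatedPair d (a j) r} ≤
      ENNReal.ofReal (Real.exp (-(M * (ρ ^ 2 / 2 * Real.exp (-(ρ * (2 * r) ^ d)))))) := by
  have := hP.1
  set p : ℝ := ρ ^ 2 / 2 * Real.exp (-(ρ * (2 * r) ^ d)) with hp
  have hp0 : 0 ≤ p := by positivity
  have hone : ∀ j, P (isolatedPair d (a j) r) = ENNReal.ofReal p := fun j => by
    simpa using hP.measure_biInter_isolatedPair hr ha {j}
  have hind : ProbabilityTheory.iIndepSet (fun j => isolatedPair d (a j) r) P := by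
    rw [ProbabilityTheory.iIndepSet_iff_meas_biInter fun j => measurableSet_isolatedPair _ _]
    intro S
    rw [hP.measure_biInter_isolatedPair hr ha S]
    exact Finset.prod_congr rfl fun j _ => (hone j).symm
  have hc := ProbabilityTheory.iIndep.meas_biInter hind (S := Finset.range M)
    (s := fun j => (isolatedPair d (a j) r)ᶜ) fun j _ =>
      (MeasurableSpace.measurableSet_generateFrom (Set.mem_singleton _)).compl
  have hset : {ξ | ∀ j < M, ξ ∉ isolatedPair d (a j) r} =
      ⋂ j ∈ Finset.range M, (isolatedPair d (a j) r)ᶜ := by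
    ext ξ; simp
  rw [hset, hc]
  have hcompl : ∀ j, P (isolatedPair d (a j) r)ᶜ ≤ ENNReal.ofReal (Real.exp (-p)) := by
    intro j
    rw [prob_compl_eq_one_sub (measurableSet_isolatedPair _ _), hone, ← ENNReal.ofReal_one,
      ← ENNReal.ofReal_sub _ hp0]
    exact ENNReal.ofReal_le_ofReal (by linarith [Real.add_one_le_exp (-p)])
  calc _ ≤ ∏ _j ∈ Finset.range M, ENNReal.ofReal (Real.exp (-p)) :=
        Finset.prod_le_prod' fun j _ => hcompl j
    _ = _ := by
        rw [Finset.prod_const, Finset.card_range, ← ENNReal.ofReal_pow (Real.exp_pos _).le,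
          ← Real.exp_nat_mul]
        congr 2
        ring

lemma ae_eventually_notMem_of_le {Ω : Type*} [MeasurableSpace Ω] {μ : Measure Ω}
    {s : ℕ → Set Ω} {g : ℕ → ℝ} (hg : Summable g)
    (h : ∀ᶠ n in atTop, μ (s n) ≤ ENNReal.ofReal (g n)) :
    ∀ᵐ ω ∂μ, ∀ᶠ n in atTop, ω ∉ s n := by
  obtain ⟨N, hN⟩ := eventually_atTop.1 h
  have hsum : ∑' n, μ (if N ≤ n then s n else ∅) ≠ ∞ := by
    refine ne_top_of_le_ne_top hg.tsum_ofReal_ne_top (ENNReal.tsum_le_tsum fun n => ?_)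
    split_ifs with hn
    · exact hN n hn
    · simp
  filter_upwards [ae_eventually_notMem hsum] with ω hω
  filter_upwards [hω, eventually_ge_atTop N] with n hn hNn
  simpa [hNn] using hn

/-- An isolation radius `r L` of order `(log L)^{1/d}` and a number `M L` of disjoint boxes of that
size along the diagonal, for which isolated pairs occur with overwhelming probability. -/
lemma exists_isolation_scale (hd : d ≠ 0) {ρ C : ℝ} (hρ : 0 < ρ) (hC : 1 ≤ C)
    (hρC : ρ ≤ 1 / (2 * 3 ^ d * C)) :
    ∃ (r : ℕ → ℝ) (M : ℕ → ℕ), ∀ᶠ L : ℕ in atTop, 1 / 2 ≤ r L ∧ 3 * r L * M L + r L ≤ L / 2 ∧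
      Real.exp (-(r L - 1 / 2) ^ d) ≤ (L : ℝ) ^ (-C) ∧
      Real.exp (-(M L * (ρ ^ 2 / 2 * Real.exp (-(ρ * (2 * r L) ^ d))))) ≤ 1 / (L : ℝ) ^ 2 := by
  set R : ℕ → ℝ := fun L => (C * Real.log L) ^ (1 / (d : ℝ)) with hR
  refine ⟨fun L => R L + 1 / 2, fun L => ⌊(L : ℝ) ^ (3 / 4 : ℝ)⌋₊, ?_⟩
  have hcast : Tendsto (fun L : ℕ => (L : ℝ)) atTop atTop := tendsto_natCast_atTop_atTop
  have hlog : Tendsto (fun L : ℕ => Real.log L) atTop atTop := Real.tendsto_log_atTop.comp hcast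
  have hlil : ∀ {s c : ℝ}, 0 < s → 0 < c → ∀ᶠ L : ℕ in atTop, Real.log L ≤ c * (L : ℝ) ^ s := by
    intro s c hs hc
    filter_upwards [hcast.eventually ((isLittleO_log_rpow_atTop hs).bound hc)] with L hL
    have h0 : (0 : ℝ) ≤ (L : ℝ) ^ s := by positivity
    rw [Real.norm_eq_abs, Real.norm_of_nonneg h0] at hL
    exact (le_abs_self _).trans hL
  have hpow : Tendsto (fun L : ℕ => (L : ℝ) ^ (1 / 8 : ℝ)) atTop atTop :=
    (tendsto_rpow_atTop (by norm_num)).comp hcast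
  filter_upwards [hlog.eventually_ge_atTop 1, eventually_ge_atTop 1, hpow.eventually_ge_atTop 8,
    hlil (s := 1 / 8) (c := 1 / (2 * C)) (by norm_num) (by positivity),
    hlil (s := 1 / 4) (c := ρ ^ 2 / 16) (by norm_num) (by positivity)] with L h1 hL1 h8 hl1 hl2
  have hL : (0 : ℝ) < L := by exact_mod_cast hL1
  have hCl : 1 ≤ C * Real.log L := one_le_mul_of_one_le_of_one_le hC h1
  have hR1 : 1 ≤ R L := Real.one_le_rpow hCl (by positivity)
  have hRd : R L ^ d = C * Real.log L := by
    simp only [hR]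
    rw [one_div, Real.rpow_inv_natCast_pow (by linarith) hd]
  have hRle : R L ≤ C * Real.log L := by
    rw [← hRd]
    exact le_self_pow₀ hR1 hd
  have hr8 : R L + 1 / 2 ≤ (L : ℝ) ^ (1 / 8 : ℝ) := by
    have : C * Real.log L ≤ (L : ℝ) ^ (1 / 8 : ℝ) / 2 := by
      calc C * Real.log L ≤ C * (1 / (2 * C) * (L : ℝ) ^ (1 / 8 : ℝ)) := by gcongr
        _ = _ := by field_simp
    linarith
  have hM1 : (⌊(L : ℝ) ^ (3 / 4 : ℝ)⌋₊ : ℝ) ≤ (L : ℝ) ^ (3 / 4 : ℝ) := Nat.floor_le (by positivity)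
  have hone : (1 : ℝ) ≤ L := by exact_mod_cast hL1
  have h34 : 1 ≤ (L : ℝ) ^ (3 / 4 : ℝ) := Real.one_le_rpow hone (by norm_num)
  have hM2 : (L : ℝ) ^ (3 / 4 : ℝ) / 2 ≤ (⌊(L : ℝ) ^ (3 / 4 : ℝ)⌋₊ : ℝ) := by
    have hf := Nat.lt_floor_add_one ((L : ℝ) ^ (3 / 4 : ℝ))
    have hf1 : (1 : ℝ) ≤ (⌊(L : ℝ) ^ (3 / 4 : ℝ)⌋₊ : ℝ) := by
      exact_mod_cast (Nat.one_le_floor_iff _).2 h34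
    linarith
  refine ⟨by linarith, ?_, ?_, ?_⟩
  · have e1 : (L : ℝ) ^ (1 / 8 : ℝ) * (L : ℝ) ^ (3 / 4 : ℝ) * (L : ℝ) ^ (1 / 8 : ℝ) = L := by
      rw [← Real.rpow_add hL, ← Real.rpow_add hL]
      norm_num
    set u := (L : ℝ) ^ (1 / 8 : ℝ)
    set v := (L : ℝ) ^ (3 / 4 : ℝ)
    calc 3 * (R L + 1 / 2) * (⌊v⌋₊ : ℝ) + (R L + 1 / 2) ≤ 3 * u * v + u * v := by
          gcongr
          nlinarith
      _ = u * v * 4 := by ring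
      _ ≤ u * v * (u / 2) := by gcongr; linarith
      _ = L / 2 := by rw [← e1]; ring
  · rw [add_sub_cancel_right, hRd, Real.rpow_def_of_pos hL]
    apply le_of_eq
    congr 1
    ring
  · have hvol : ρ * (2 * (R L + 1 / 2)) ^ d ≤ 1 / 2 * Real.log L := by
      calc ρ * (2 * (R L + 1 / 2)) ^ d ≤ 1 / (2 * 3 ^ d * C) * (3 * R L) ^ d := by
            have : 2 * (R L + 1 / 2) ≤ 3 * R L := by linarith
            gcongr
        _ = _ := by
            rw [mul_pow, hRd]
            field_simp
    have hexp : (L : ℝ) ^ (-(1 / 2) : ℝ) ≤ Real.exp (-(ρ * (2 * (R L + 1 / 2)) ^ d)) := by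
      rw [Real.rpow_def_of_pos hL]
      exact Real.exp_le_exp.2 (by linarith)
    have e2 : (L : ℝ) ^ (3 / 4 : ℝ) * (L : ℝ) ^ (-(1 / 2) : ℝ) = (L : ℝ) ^ (1 / 4 : ℝ) := by
      rw [← Real.rpow_add hL]
      norm_num
    have hmain : 2 * Real.log L ≤ (⌊(L : ℝ) ^ (3 / 4 : ℝ)⌋₊ : ℝ) *
        (ρ ^ 2 / 2 * Real.exp (-(ρ * (2 * (R L + 1 / 2)) ^ d))) := by
      calc 2 * Real.log L ≤ 2 * (ρ ^ 2 / 16 * (L : ℝ) ^ (1 / 4 : ℝ)) := by gcongr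
        _ ≤ ρ ^ 2 / 4 * (L : ℝ) ^ (1 / 4 : ℝ) := by
            have : 0 ≤ ρ ^ 2 * (L : ℝ) ^ (1 / 4 : ℝ) := by positivity
            linarith
        _ = (L : ℝ) ^ (3 / 4 : ℝ) / 2 * (ρ ^ 2 / 2 * (L : ℝ) ^ (-(1 / 2) : ℝ)) := by
            rw [← e2]; ring
        _ ≤ _ := by gcongr
    calc _ ≤ Real.exp (-(2 * Real.log L)) := Real.exp_le_exp.2 (neg_le_neg hmain)
      _ = 1 / (L : ℝ) ^ 2 := by
        rw [Real.exp_neg, two_mul, Real.exp_add, Real.exp_log hL]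
        field_simp

lemma exists_pair_of_mem_isolatedPair {ξ : Config d} {a r L : ℝ} (i : ℕ) (hr : 1 / 2 ≤ r)
    (hξ : ξ ∈ isolatedPair d a r) (hL : diagBox d a r ⊆ cube d L) (hfin : (ξ ∩ cube d L).Finite) :
    ∃ U : Finset (Pt d), U ⊆ hfin.toFinset ∧ U.Nonempty ∧ (U : Set (Pt d)) ⊆ diagBox d a r ∧
      (∀ x ∈ U, Real.exp (-(d : ℝ) ^ d) ≤ wgt d hfin.toFinset i x) ∧
      ∀ x ∈ U, ∀ y ∈ hfin.toFinset, y ∉ U → rate d x y ≤ Real.exp (-(r - 1 / 2) ^ d) := by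
  obtain ⟨h2, h0⟩ := hξ
  obtain ⟨p, q, hpq, hset⟩ := Set.ncard_eq_two.1 h2
  have hsub : diagBox d a (1 / 2) ⊆ diagBox d a r := diagBox_subset (by simpa using hr)
  have hmem : ∀ x, x ∈ ({p, q} : Finset (Pt d)) ↔ x ∈ ξ ∧ x ∈ diagBox d a (1 / 2) := by
    intro x
    rw [← Set.mem_inter_iff, hset]
    simp
  have hE : ∀ x ∈ ({p, q} : Finset (Pt d)), x ∈ hfin.toFinset := by
    intro x hx
    obtain ⟨hx1, hx2⟩ := (hmem x).1 hx
    exact hfin.mem_toFinset.2 ⟨hx1, hL (hsub hx2)⟩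
  have hp : p ∈ ({p, q} : Finset (Pt d)) := by simp
  have hq : q ∈ ({p, q} : Finset (Pt d)) := by simp
  have hrate : ∀ x ∈ ({p, q} : Finset (Pt d)), ∀ y ∈ ({p, q} : Finset (Pt d)),
      Real.exp (-(d : ℝ) ^ d) ≤ rate d x y := by
    intro x hx y hy
    have := dist_le_of_mem_diagBox ((hmem x).1 hx).2 ((hmem y).1 hy).2
    unfold rate
    rw [Real.rpow_natCast]
    gcongr
    simpa using this
  have hκ : Real.exp (-(d : ℝ) ^ d) ≤ 1 := Real.exp_le_one_iff.2 (by simp)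
  refine ⟨{p, q}, hE, ⟨p, hp⟩, fun x hx => hsub ((hmem x).1 hx).2, ?_, ?_⟩
  · intro x hx
    by_cases hxp : x = p
    · exact le_wgt i hκ (hE q hq) (hxp ▸ hpq.symm) (hrate x hx q hq)
    · exact le_wgt i hκ (hE p hp) (Ne.symm hxp) (hrate x hx p hp)
  · intro x hx y hy hyU
    obtain ⟨hy1, hy2⟩ := hfin.mem_toFinset.1 hy
    have hfin' : (ξ ∩ (diagBox d a r \ diagBox d a (1 / 2))).Finite :=
      hfin.subset (Set.inter_subset_inter_right _ (Set.sdiff_subset.trans hL))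
    have hempty := (Set.ncard_eq_zero hfin').1 h0
    have hyr : y ∉ diagBox d a r := by
      intro hyr
      have : y ∈ ξ ∩ (diagBox d a r \ diagBox d a (1 / 2)) :=
        ⟨hy1, hyr, fun h => hyU ((hmem y).2 ⟨hy1, h⟩)⟩
      rw [hempty] at this
      exact this
    have := le_dist_of_mem_diagBox ((hmem x).1 hx).2 hyr
    unfold rate
    rw [Real.rpow_natCast]
    gcongr

/-- Two disjoint isolated pairs force a large Poincaré constant. -/
lemma le_gammaP_of_isolatedPair [NeZero d] {ξ : Config d} {a b r L : ℝ} (i : ℕ) (hr : 1 / 2 ≤ r)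
    (ha : ξ ∈ isolatedPair d a r) (hb : ξ ∈ isolatedPair d b r) (hab : 2 * r < |a - b|)
    (haL : diagBox d a r ⊆ cube d L) (hbL : diagBox d b r ⊆ cube d L)
    (hfin : (ξ ∩ cube d L).Finite) :
    ENNReal.ofReal (Real.exp (-(d : ℝ) ^ d) /
      (2 * Real.exp (-(r - 1 / 2) ^ d) * hfin.toFinset.card)) ≤ gammaP d hfin.toFinset i := by
  obtain ⟨U, hUE, hUne, hUa, hUw, hUc⟩ := exists_pair_of_mem_isolatedPair i hr ha haL hfin
  obtain ⟨V, hVE, hVne, hVb, hVw, hVc⟩ := exists_pair_of_mem_isolatedPair i hr hb hbL hfin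
  have hUV : Disjoint U V := Finset.disjoint_coe.1 ((disjoint_diagBox hab).mono hUa hVb)
  rcases le_total (Wsum d hfin.toFinset i U) (Wsum d hfin.toFinset i V) with h | h
  · exact le_gammaP_of_weakly_connected (Real.exp_pos _) (Real.exp_pos _) hUE hVE hUne hVne hUV
      hUw h hUc
  · exact le_gammaP_of_weakly_connected (Real.exp_pos _) (Real.exp_pos _) hVE hUE hVne hUne
      hUV.symm hVw h hVc

/-- Theorem 1.3(2): subdiffusive lower bound for `α = d` at small density. -/
theorem stmt_5 (hd : 2 ≤ d) (δ : ℝ) (hδ : 0 < δ) :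
    ∃ ρ₀ : ℝ, 0 < ρ₀ ∧ ∀ ρ : ℝ, 0 < ρ → ρ ≤ ρ₀ →
      ∀ P : Measure (Config d), IsPoissonPP d ρ P →
        ∀ i ∈ ({1, 2, 3} : Set ℕ),
          ∀ᵐ ξ ∂P, ∀ᶠ L : ℕ in atTop, ∀ hfin : (ξ ∩ cube d L).Finite,
            ENNReal.ofReal ((L : ℝ) ^ (1 / δ)) ≤ gammaP (d : ℝ) hfin.toFinset i := by
  have hd0 : d ≠ 0 := by omega
  have : NeZero d := ⟨hd0⟩
  set C : ℝ := d + 3 + 1 / δ with hC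
  have hδ' : 0 < 1 / δ := by positivity
  have hC1 : 1 ≤ C := by
    have : (0 : ℝ) ≤ d := Nat.cast_nonneg d
    linarith
  refine ⟨1 / (2 * 3 ^ d * C), by positivity, fun ρ hρ hρC P hP i _ => ?_⟩
  obtain ⟨r, M, hrM⟩ := exists_isolation_scale hd0 hρ hC1 hρC
  have hcard : ∀ᵐ ξ ∂P, ∀ᶠ L : ℕ in atTop,
      ξ ∉ {ξ : Config d | (L : ℝ) ^ (d + 2) ≤ (ξ ∩ cube d L).ncard} := by
    refine ae_eventually_notMem_of_le
      ((Real.summable_one_div_nat_pow.2 one_lt_two).mul_left ρ) ?_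
    filter_upwards [eventually_ge_atTop 1] with L hL
    have hL0 : (0 : ℝ) < L := by exact_mod_cast hL
    rw [cube_eq_diagBox]
    refine (hP.measure_le_ncard hρ.le (isBounded_diagBox _ _) (measurableSet_diagBox _ _)
      (by positivity)).trans (le_of_eq ?_)
    rw [volume_diagBox _ (by positivity), ENNReal.toReal_ofReal (by positivity)]
    congr 1
    rw [mul_div_cancel₀ _ (two_ne_zero' ℝ), pow_add]
    field_simp
  have hpair : ∀ σ : ℝ, |σ| = 1 → ∀ᵐ ξ ∂P, ∀ᶠ L : ℕ in atTop,
      ξ ∉ {ξ : Config d | ∀ j < M L, ξ ∉ isolatedPair d (σ * (3 * r L * ((j : ℕ) + 1))) (r L)} := by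
    intro σ hσ
    refine ae_eventually_notMem_of_le (Real.summable_one_div_nat_pow.2 one_lt_two) ?_
    filter_upwards [hrM] with L hL
    obtain ⟨h1, -, -, h4⟩ := hL
    refine (hP.measure_forall_notMem_isolatedPair h1 ?_ (M L)).trans
      (ENNReal.ofReal_le_ofReal h4)
    intro j k hjk
    have hjk' : (1 : ℝ) ≤ |(j : ℝ) - k| := by
      have : (1 : ℤ) ≤ |(j : ℤ) - k| := Int.one_le_abs (sub_ne_zero.2 (by exact_mod_cast hjk))
      exact_mod_cast this
    rw [← mul_sub, abs_mul, hσ, one_mul, ← mul_sub, abs_mul, add_sub_add_right_eq_sub,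
      abs_of_pos (by linarith : 0 < 3 * r L)]
    nlinarith
  have hlarge : ∀ᶠ L : ℕ in atTop, 2 / Real.exp (-(d : ℝ) ^ d) ≤ (L : ℝ) :=
    tendsto_natCast_atTop_atTop.eventually_ge_atTop _
  filter_upwards [hcard, hpair 1 (by simp), hpair (-1) (by simp)] with ξ hξ hξ₁ hξ₂
  filter_upwards [hξ, hξ₁, hξ₂, hrM, hlarge, eventually_ge_atTop 1] with L hN hj hk hL hκ hL1 hfin
  simp only [not_forall, not_not, not_le, one_mul, neg_mul] at hN hj hk
  obtain ⟨j, hjM, hj⟩ := hj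
  obtain ⟨k, hkM, hk⟩ := hk
  obtain ⟨hr, hM, hη, -⟩ := hL
  have hL0 : (0 : ℝ) < L := by exact_mod_cast hL1
  have hin : ∀ n < M L, 3 * r L * ((n : ℝ) + 1) + r L ≤ L / 2 := by
    intro n hn
    have : (n : ℝ) + 1 ≤ M L := by exact_mod_cast hn
    nlinarith
  have hpos : ∀ n : ℕ, 3 * r L ≤ 3 * r L * ((n : ℝ) + 1) := fun n =>
    le_mul_of_one_le_right (by linarith) (by simp)
  have hjp := hpos j
  have hkp := hpos k
  refine le_trans (ENNReal.ofReal_le_ofReal ?_) (le_gammaP_of_isolatedPair i hr hj hk ?_ ?_ ?_ hfin)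
  · set κ := Real.exp (-(d : ℝ) ^ d)
    have hκ0 : 0 < κ := Real.exp_pos _
    have hcardpos : (0 : ℝ) < hfin.toFinset.card := by
      obtain ⟨U, hU, ⟨x, hx⟩, -⟩ := exists_pair_of_mem_isolatedPair i hr hj (by
        rw [cube_eq_diagBox]
        refine diagBox_subset ?_
        rw [sub_zero, abs_of_nonneg (by linarith)]
        exact hin j hjM) hfin
      exact_mod_cast Finset.card_pos.2 ⟨x, hU hx⟩
    have hcardle : (hfin.toFinset.card : ℝ) ≤ (L : ℝ) ^ (d + 2) := by
      rw [← Set.ncard_eq_toFinset_card _ hfin]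
      exact hN.le
    rw [le_div_iff₀ (by positivity)]
    have hpow : (L : ℝ) ^ (1 / δ) * (L : ℝ) ^ (-C) * (L : ℝ) ^ (d + 2) * L = 1 := by
      calc _ = (L : ℝ) ^ (1 / δ) * (L : ℝ) ^ (-C) * (L : ℝ) ^ ((d + 2 : ℕ) : ℝ) *
            (L : ℝ) ^ (1 : ℝ) := by rw [Real.rpow_natCast, Real.rpow_one]
        _ = (L : ℝ) ^ (0 : ℝ) := by
          rw [← Real.rpow_add hL0, ← Real.rpow_add hL0, ← Real.rpow_add hL0, hC]
          congr 1
          push_cast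
          ring
        _ = 1 := Real.rpow_zero _
    have h2 : 2 ≤ κ * L := by
      rw [div_le_iff₀ hκ0] at hκ
      linarith
    calc (L : ℝ) ^ (1 / δ) * (2 * Real.exp (-(r L - 1 / 2) ^ d) * hfin.toFinset.card)
        ≤ (L : ℝ) ^ (1 / δ) * (κ * L * (L : ℝ) ^ (-C) * (L : ℝ) ^ (d + 2)) := by gcongr
      _ = κ * ((L : ℝ) ^ (1 / δ) * (L : ℝ) ^ (-C) * (L : ℝ) ^ (d + 2) * L) := by ring
      _ = κ := by rw [hpow, mul_one]
  · rw [sub_neg_eq_add, abs_of_nonneg (by linarith)]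
    linarith
  · rw [cube_eq_diagBox]
    refine diagBox_subset ?_
    rw [sub_zero, abs_of_nonneg (by linarith)]
    exact hin j hjM
  · rw [cube_eq_diagBox]
    refine diagBox_subset ?_
    rw [sub_zero, abs_neg, abs_of_nonneg (by linarith)]
    exact hin k hkM

end
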